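/- arXiv:2011.08989 — 10 statements merged into one kernel-verified Lean document; each statement's English description precedes it below -/
import Mathlib

section
/- Let g, c ∈ ℂ with c ≠ 0 and c ≠ −9g². Let S₁ = [[0,0,1],[0,1,0],[1,0,0]], S₂ = [[0,0,0],[0,0,1],[0,1,0]], S₃ = [[−1,0,g],[0,−2g,0],[g,0,c]] (a net of conics of type A). Then there exists a ℂ-linear automorphism T of the six-dimensional space of symmetric 3×3 complex matrices such that for all α, β, γ ∈ ℂ, the adjugate of α·S₁ + β·S₂ + γ·S₃ equals T(w wᵀ), where w = (α, β, γ) and w wᵀ is the symmetric matrix with (i,j)-entry wᵢwⱼ. In particular, the reciprocal surface of this net is projectively equivalent to the Veronese surface. -/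
open Matrix

/-- The six-dimensional space of symmetric 3×3 complex matrices. -/
noncomputable def Sym3 : Submodule ℂ (Matrix (Fin 3) (Fin 3) ℂ) where
  carrier := {M | M.IsSymm}
  add_mem' ha hb := ha.add hb
  zero_mem' := Matrix.isSymm_zero
  smul_mem' c M hM := hM.smul c

lemma vecMulVec_isSymm (w : Fin 3 → ℂ) : (vecMulVec w w).IsSymm := by
  ext i j
  simp [Matrix.IsSymm, Matrix.vecMulVec_apply, mul_comm]

/-- The linear map on symmetric matrices sending `w wᵀ`, for `w = (α, β, γ)`, to the adjugate of
the member of the type A net with coefficients `α`, `β`, `γ`. -/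
noncomputable def typeAReciprocal (g c : ℂ) : Sym3 →ₗ[ℂ] Sym3 where
  toFun X :=
    ⟨!![c * X.1 0 2 - 2 * g * c * X.1 2 2 - X.1 1 1,
          X.1 0 1 + g * X.1 1 2,
          -X.1 0 0 + g * X.1 0 2 + 2 * g ^ 2 * X.1 2 2;
        X.1 0 1 + g * X.1 1 2,
          -X.1 0 0 - 2 * g * X.1 0 2 - (g ^ 2 + c) * X.1 2 2,
          X.1 1 2;
        -X.1 0 0 + g * X.1 0 2 + 2 * g ^ 2 * X.1 2 2,
          X.1 1 2,
          -X.1 0 2 + 2 * g * X.1 2 2], by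
      change Matrix.IsSymm _
      ext i j
      fin_cases i <;> fin_cases j <;> rfl⟩
  map_add' X Y := by
    ext i j
    fin_cases i <;> fin_cases j <;> simp <;> ring
  map_smul' a X := by
    ext i j
    fin_cases i <;> fin_cases j <;> simp <;> ring

lemma typeAReciprocal_injective {g c : ℂ} (hc9 : c ≠ -9 * g ^ 2) :
    Function.Injective (typeAReciprocal g c) := by
  rw [injective_iff_map_eq_zero]
  rintro ⟨X, hX⟩ h
  have entry (i j : Fin 3) : (typeAReciprocal g c ⟨X, hX⟩).1 i j = 0 := by rw [h]; rfl
  have h00 : c * X 0 2 - 2 * g * c * X 2 2 - X 1 1 = 0 := entry 0 0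
  have h01 : X 0 1 + g * X 1 2 = 0 := entry 0 1
  have h02 : -X 0 0 + g * X 0 2 + 2 * g ^ 2 * X 2 2 = 0 := entry 0 2
  have h11 : -X 0 0 - 2 * g * X 0 2 - (g ^ 2 + c) * X 2 2 = 0 := entry 1 1
  have h12 : X 1 2 = 0 := entry 1 2
  have h22 : -X 0 2 + 2 * g * X 2 2 = 0 := entry 2 2
  have hne : c + 9 * g ^ 2 ≠ 0 := fun h0 => hc9 (by linear_combination h0)
  have x22 : X 2 2 = 0 := by
    refine (mul_eq_zero.mp ?_).resolve_left hne
    linear_combination h02 - h11 + 3 * g * h22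
  have x02 : X 0 2 = 0 := by linear_combination 2 * g * x22 - h22
  have x00 : X 0 0 = 0 := by linear_combination g * x02 + 2 * g ^ 2 * x22 - h02
  have x11 : X 1 1 = 0 := by linear_combination c * x02 - 2 * g * c * x22 - h00
  have x01 : X 0 1 = 0 := by linear_combination h01 - g * h12
  have symm (i j : Fin 3) : X j i = X i j := Matrix.IsSymm.apply hX i j
  ext i j
  fin_cases i <;> fin_cases j <;> simp [x00, x01, x02, x11, h12, x22, symm 0 1, symm 0 2, symm 1 2]

/-- For a net of conics of type A, the adjugate map factors as a linear
automorphism of the space of symmetric matrices composed with the Veronese map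
(α,β,γ) ↦ w wᵀ; hence the reciprocal surface is projectively equivalent to the
Veronese surface. -/
theorem typeA_reciprocal_is_Veronese (g c : ℂ) (hc : c ≠ 0) (hc9 : c ≠ -9 * g ^ 2) :
    ∃ T : Sym3 ≃ₗ[ℂ] Sym3, ∀ α β γ : ℂ,
      (α • (!![0,0,1;0,1,0;1,0,0] : Matrix (Fin 3) (Fin 3) ℂ)
          + β • !![0,0,0;0,0,1;0,1,0]
          + γ • !![-1,0,g;0,-2*g,0;g,0,c]).adjugate
        = (T ⟨vecMulVec ![α, β, γ] ![α, β, γ], vecMulVec_isSymm _⟩ :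
            Matrix (Fin 3) (Fin 3) ℂ) := by
  refine ⟨LinearEquiv.ofInjectiveEndo (typeAReciprocal g c) (typeAReciprocal_injective hc9),
    fun α β γ => ?_⟩
  rw [LinearEquiv.coe_ofInjectiveEndo, Matrix.adjugate_fin_three]
  ext i j
  fin_cases i <;> fin_cases j <;> simp [typeAReciprocal] <;> ring
end

section
/- Let S₁ = [[0,0,1],[0,1,0],[1,0,0]], S₂ = [[0,0,0],[0,0,1],[0,1,0]], S₃ = [[−1,0,1],[0,−2,0],[1,0,0]] (a net of conics of type B*). Then there exists a ℂ-linear automorphism T of the six-dimensional space of symmetric 3×3 complex matrices such that for all α, β, γ ∈ ℂ, the adjugate of α·S₁ + β·S₂ + γ·S₃ equals T(w wᵀ), where w = (α, β, γ) and w wᵀ is the symmetric matrix with (i,j)-entry wᵢwⱼ. In particular, the reciprocal surface of this net is projectively equivalent to the Veronese surface. -/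
open Matrix

/-- The linear map sending `w wᵀ` to the adjugate of the member of the net with coordinates `w`. -/
noncomputable def typeBstarMap (X : Matrix (Fin 3) (Fin 3) ℂ) : Matrix (Fin 3) (Fin 3) ℂ :=
  !![-X 1 1, X 0 1 + X 1 2, -X 0 0 + X 0 2 + 2 * X 2 2;
     X 0 1 + X 1 2, -X 0 0 - 2 * X 0 2 - X 2 2, X 1 2;
     -X 0 0 + X 0 2 + 2 * X 2 2, X 1 2, -X 0 2 + 2 * X 2 2]

/-- The inverse of `typeBstarMap` on symmetric matrices. -/
noncomputable def typeBstarInv (Y : Matrix (Fin 3) (Fin 3) ℂ) : Matrix (Fin 3) (Fin 3) ℂ :=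
  !![4 * (Y 0 2 - Y 1 1) / 9 + Y 2 2 / 3 - Y 0 2, Y 0 1 - Y 1 2,
       2 * (Y 0 2 - Y 1 1) / 9 - Y 2 2 / 3;
     Y 0 1 - Y 1 2, -Y 0 0, Y 1 2;
     2 * (Y 0 2 - Y 1 1) / 9 - Y 2 2 / 3, Y 1 2, (Y 0 2 - Y 1 1) / 9 + Y 2 2 / 3]

lemma typeBstarMap_isSymm (X : Matrix (Fin 3) (Fin 3) ℂ) : (typeBstarMap X).IsSymm := by
  ext i j
  fin_cases i <;> fin_cases j <;> rfl

lemma typeBstarInv_isSymm (Y : Matrix (Fin 3) (Fin 3) ℂ) : (typeBstarInv Y).IsSymm := by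
  ext i j
  fin_cases i <;> fin_cases j <;> rfl

lemma typeBstarInv_typeBstarMap {X : Matrix (Fin 3) (Fin 3) ℂ} (hX : X.IsSymm) :
    typeBstarInv (typeBstarMap X) = X := by
  have h₁ := hX.apply 0 1
  have h₂ := hX.apply 0 2
  have h₃ := hX.apply 1 2
  ext i j
  fin_cases i <;> fin_cases j <;> simp [typeBstarMap, typeBstarInv, h₁, h₂, h₃] <;> ring

lemma typeBstarMap_typeBstarInv {Y : Matrix (Fin 3) (Fin 3) ℂ} (hY : Y.IsSymm) :
    typeBstarMap (typeBstarInv Y) = Y := by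
  have h₁ := hY.apply 0 1
  have h₂ := hY.apply 0 2
  have h₃ := hY.apply 1 2
  ext i j
  fin_cases i <;> fin_cases j <;> simp [typeBstarMap, typeBstarInv, h₁, h₂, h₃] <;> ring

/-- `typeBstarMap` as a linear automorphism of the space of symmetric matrices. -/
noncomputable def typeBstarEquiv : Sym3 ≃ₗ[ℂ] Sym3 where
  toFun X := ⟨typeBstarMap X, typeBstarMap_isSymm _⟩
  invFun Y := ⟨typeBstarInv Y, typeBstarInv_isSymm _⟩
  map_add' X Y := by
    ext i j
    fin_cases i <;> fin_cases j <;> simp [typeBstarMap] <;> ring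
  map_smul' c X := by
    ext i j
    fin_cases i <;> fin_cases j <;> simp [typeBstarMap] <;> ring
  left_inv X := Subtype.ext (typeBstarInv_typeBstarMap X.2)
  right_inv Y := Subtype.ext (typeBstarMap_typeBstarInv Y.2)

/-- For the net of conics of type B*, the adjugate map factors as a linear
automorphism of the space of symmetric matrices composed with the Veronese map;
hence the reciprocal surface is projectively equivalent to the Veronese surface. -/
theorem typeBstar_reciprocal_is_Veronese :
    ∃ T : Sym3 ≃ₗ[ℂ] Sym3, ∀ α β γ : ℂ,
      (α • (!![0,0,1;0,1,0;1,0,0] : Matrix (Fin 3) (Fin 3) ℂ)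
          + β • !![0,0,0;0,0,1;0,1,0]
          + γ • !![-1,0,1;0,-2,0;1,0,0]).adjugate
        = (T ⟨vecMulVec ![α, β, γ] ![α, β, γ], vecMulVec_isSymm _⟩ :
            Matrix (Fin 3) (Fin 3) ℂ) := by
  refine ⟨typeBstarEquiv, fun α β γ => ?_⟩
  change _ = typeBstarMap (vecMulVec ![α, β, γ] ![α, β, γ])
  rw [adjugate_fin_three]
  ext i j
  fin_cases i <;> fin_cases j <;> simp [typeBstarMap, vecMulVec_apply] <;> ring
end

section
/- Let S₁ = [[0,0,1],[0,0,0],[1,0,0]], S₂ = [[0,0,0],[0,0,1],[0,1,0]], S₃ = [[0,1,0],[1,0,0],[0,0,1]] (a net of conics of type D*). Then there exists a ℂ-linear automorphism T of the six-dimensional space of symmetric 3×3 complex matrices such that for all α, β, γ ∈ ℂ, the adjugate of α·S₁ + β·S₂ + γ·S₃ equals T(w wᵀ), where w = (α, β, γ) and w wᵀ is the symmetric matrix with (i,j)-entry wᵢwⱼ. In particular, the reciprocal surface of this net is projectively equivalent to the Veronese surface. -/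
open Matrix

/-- The linear automorphism of symmetric matrices carrying `w wᵀ` to the adjugate of the
corresponding member of the net of type D*. -/
noncomputable def adjugateEquivDstar : Sym3 ≃ₗ[ℂ] Sym3 where
  toFun X := ⟨!![-X.1 1 1, X.1 0 1 - X.1 2 2, X.1 1 2;
                 X.1 0 1 - X.1 2 2, -X.1 0 0, X.1 0 2;
                 X.1 1 2, X.1 0 2, -X.1 2 2], by
    ext i j
    fin_cases i <;> fin_cases j <;> rfl⟩
  map_add' X Y := by
    ext i j
    fin_cases i <;> fin_cases j <;> simp <;> ring
  map_smul' c X := by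
    ext i j
    fin_cases i <;> fin_cases j <;> simp <;> ring
  invFun Y := ⟨!![-Y.1 1 1, Y.1 0 1 - Y.1 2 2, Y.1 1 2;
                  Y.1 0 1 - Y.1 2 2, -Y.1 0 0, Y.1 0 2;
                  Y.1 1 2, Y.1 0 2, -Y.1 2 2], by
    ext i j
    fin_cases i <;> fin_cases j <;> rfl⟩
  left_inv X := by
    have h : X.1.IsSymm := X.2
    ext i j
    fin_cases i <;> fin_cases j <;> simp [h.apply 0 1, h.apply 0 2, h.apply 1 2]
  right_inv Y := by
    have h : Y.1.IsSymm := Y.2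
    ext i j
    fin_cases i <;> fin_cases j <;> simp [h.apply 0 1, h.apply 0 2, h.apply 1 2]

/-- For the net of conics of type D*, the adjugate map factors as a linear
automorphism of the space of symmetric matrices composed with the Veronese map;
hence the reciprocal surface is projectively equivalent to the Veronese surface. -/
theorem typeDstar_reciprocal_is_Veronese :
    ∃ T : Sym3 ≃ₗ[ℂ] Sym3, ∀ α β γ : ℂ,
      (α • (!![0,0,1;0,0,0;1,0,0] : Matrix (Fin 3) (Fin 3) ℂ)
          + β • !![0,0,0;0,0,1;0,1,0]
          + γ • !![0,1,0;1,0,0;0,0,1]).adjugate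
        = (T ⟨vecMulVec ![α, β, γ] ![α, β, γ], vecMulVec_isSymm _⟩ :
            Matrix (Fin 3) (Fin 3) ℂ) := by
  refine ⟨adjugateEquivDstar, fun α β γ => ?_⟩
  ext i j
  fin_cases i <;> fin_cases j <;>
    simp [adjugateEquivDstar, adjugate_fin_three] <;> ring
end

section
/- Let S₁ = [[0,0,1],[0,0,0],[1,0,0]], S₂ = [[0,0,0],[0,0,1],[0,1,0]], S₃ = [[0,1,0],[1,0,0],[0,0,0]] (a net of conics of type E*). Then there exists a ℂ-linear automorphism T of the six-dimensional space of symmetric 3×3 complex matrices such that for all α, β, γ ∈ ℂ, the adjugate of α·S₁ + β·S₂ + γ·S₃ equals T(w wᵀ), where w = (α, β, γ) and w wᵀ is the symmetric matrix with (i,j)-entry wᵢwⱼ. In particular, the reciprocal surface of this net is projectively equivalent to the Veronese surface. -/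
open Matrix

/-- The linear involution of the space of symmetric matrices which swaps and negates the first two
diagonal entries, negates the last one, and swaps the last two off-diagonal entries. -/
noncomputable def signedEntrySwap : Sym3 →ₗ[ℂ] Sym3 where
  toFun N := ⟨!![-N.1 1 1, N.1 0 1, N.1 1 2;
                 N.1 0 1, -N.1 0 0, N.1 0 2;
                 N.1 1 2, N.1 0 2, -N.1 2 2], by
    change Matrix.IsSymm _
    ext i j
    fin_cases i <;> fin_cases j <;> rfl⟩
  map_add' M N := by
    ext i j
    fin_cases i <;> fin_cases j <;> simp <;> ring
  map_smul' c M := by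
    ext i j
    fin_cases i <;> fin_cases j <;> simp

lemma signedEntrySwap_involutive : Function.Involutive signedEntrySwap := by
  intro N
  have hN : N.1.IsSymm := N.2
  ext i j
  fin_cases i <;> fin_cases j <;>
    simp [signedEntrySwap, hN.apply 0 1, hN.apply 0 2, hN.apply 1 2]

/-- For the net of conics of type E*, the adjugate map factors as a linear
automorphism of the space of symmetric matrices composed with the Veronese map;
hence the reciprocal surface is projectively equivalent to the Veronese surface. -/
theorem typeEstar_reciprocal_is_Veronese :
    ∃ T : Sym3 ≃ₗ[ℂ] Sym3, ∀ α β γ : ℂ,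
      (α • (!![0,0,1;0,0,0;1,0,0] : Matrix (Fin 3) (Fin 3) ℂ)
          + β • !![0,0,0;0,0,1;0,1,0]
          + γ • !![0,1,0;1,0,0;0,0,0]).adjugate
        = (T ⟨vecMulVec ![α, β, γ] ![α, β, γ], vecMulVec_isSymm _⟩ :
            Matrix (Fin 3) (Fin 3) ℂ) := by
  refine ⟨LinearEquiv.ofInvolutive signedEntrySwap signedEntrySwap_involutive, fun α β γ => ?_⟩
  ext i j
  fin_cases i <;> fin_cases j <;>
    simp [signedEntrySwap, adjugate_fin_three] <;> ring
end

section
/- Let g, c ∈ ℂ with c ≠ 0 and c ≠ −9g². Let S₁ = [[0,0,1],[0,1,0],[1,0,0]], S₂ = [[0,0,0],[0,0,1],[0,1,0]], S₃ = [[−1,0,g],[0,−2g,0],[g,0,c]]. Then for all α, β, γ ∈ ℂ, the matrix α·S₁ + β·S₂ + γ·S₃ does not have rank 1; that is, the net of conics of type A contains no matrix of rank 1. -/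
open Matrix

/-- The `2 × 2` minors of a matrix of rank at most one vanish. -/
theorem Matrix.mul_eq_mul_of_rank_le_one {m n K : Type*} [Fintype m] [Fintype n] [Field K]
    {A : Matrix m n K} (h : A.rank ≤ 1) (i k : m) (j l : n) :
    A i j * A k l = A i l * A k j := by
  rw [rank_eq_finrank_span_cols] at h
  obtain ⟨v, hv⟩ := finrank_le_one_iff.mp h
  have hcol (j : n) : ∃ a : K, ∀ i, A i j = a * v.1 i := by
    obtain ⟨a, ha⟩ := hv ⟨A.col j, Submodule.subset_span ⟨j, rfl⟩⟩
    exact ⟨a, fun i => (congrFun (congrArg Subtype.val ha) i).symm⟩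
  obtain ⟨a, ha⟩ := hcol j
  obtain ⟨b, hb⟩ := hcol l
  rw [ha, ha, hb, hb]
  ring

/-- A net of conics of type A contains no matrix of rank 1. -/
theorem typeA_no_rank_one (g c : ℂ) (hc : c ≠ 0) (hc9 : c ≠ -9 * g ^ 2)
    (α β γ : ℂ) :
    (α • (!![0,0,1;0,1,0;1,0,0] : Matrix (Fin 3) (Fin 3) ℂ)
        + β • !![0,0,0;0,0,1;0,1,0]
        + γ • !![-1,0,g;0,-2*g,0;g,0,c]).rank ≠ 1 := by
  intro h
  have minor := mul_eq_mul_of_rank_le_one h.le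
  have h₁ := minor 0 1 0 1
  have h₂ := minor 0 2 0 2
  have h₃ := minor 1 2 1 2
  simp at h₁ h₂ h₃
  by_cases hγ : γ = 0
  · subst hγ
    obtain rfl : α = 0 := by simpa using h₂
    obtain rfl : β = 0 := by simpa using h₃
    simp at h
  · have hα : α = 2 * g * γ := by
      have := h₁.resolve_left hγ
      linear_combination this
    subst hα
    apply hc9
    apply mul_left_cancel₀ (pow_ne_zero 2 hγ)
    linear_combination -h₂
end

section
/- Let S₁ = [[0,0,1],[0,1,0],[1,0,0]], S₂ = [[0,0,0],[0,0,1],[0,1,0]], S₃ = [[−1,0,1],[0,−2,0],[1,0,0]]. Then for all α, β, γ ∈ ℂ, the matrix α·S₁ + β·S₂ + γ·S₃ does not have rank 1; that is, the net of conics of type B* contains no matrix of rank 1. -/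
open Matrix

/-- Every minor of size larger than the rank vanishes. -/
theorem Matrix.det_submatrix_eq_zero_of_rank_lt {R m n k : Type*} [CommRing R] [IsDomain R]
    [Fintype n] [Fintype k] [DecidableEq k] (A : Matrix m n R) (r : k → m) (c : k → n)
    (h : A.rank < Fintype.card k) : (A.submatrix r c).det = 0 := by
  by_contra hdet
  have hle := A.rank_submatrix_le r c
  rw [rank_of_det_ne_zero hdet] at hle
  exact hle.not_gt h

/-- The net of conics of type B* contains no matrix of rank 1. -/
theorem typeBstar_no_rank_one (α β γ : ℂ) :
    (α • (!![0,0,1;0,1,0;1,0,0] : Matrix (Fin 3) (Fin 3) ℂ)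
        + β • !![0,0,0;0,0,1;0,1,0]
        + γ • !![-1,0,1;0,-2,0;1,0,0]).rank ≠ 1 := by
  intro h
  have minor (r c : Fin 2 → Fin 3) :=
    det_submatrix_eq_zero_of_rank_lt _ r c (h.trans_lt (by simp))
  have h₁ := minor ![0, 2] ![0, 2]
  have h₂ := minor ![1, 2] ![1, 2]
  have h₃ := minor ![0, 1] ![0, 1]
  rw [det_fin_two] at h₁ h₂ h₃
  simp at h₁ h₂ h₃
  have hβ : β = 0 := by grind
  have hγ : γ = 0 := by grind
  have hα : α = 0 := by grind
  subst hα hβ hγ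
  simp at h
end

section
/- Let S₁ = [[0,0,1],[0,0,0],[1,0,0]], S₂ = [[0,0,0],[0,0,1],[0,1,0]], S₃ = [[0,1,0],[1,0,0],[0,0,1]]. Then for all α, β, γ ∈ ℂ, the matrix α·S₁ + β·S₂ + γ·S₃ does not have rank 1; that is, the net of conics of type D* contains no matrix of rank 1. -/
open Matrix

/-- The `2 × 2` minors of a matrix of rank at most one vanish. -/
theorem Matrix.mul_apply_eq_of_rank_le_one {m n K : Type*} [Fintype n] [Finite m] [Field K]
    {A : Matrix m n K} (hA : A.rank ≤ 1) (i j : m) (k l : n) :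
    A i k * A j l = A i l * A j k := by
  classical
  obtain ⟨v, hv⟩ := finrank_le_one_iff.mp hA
  have hcol (q : n) : ∃ c : K, ∀ p, c * (v : m → K) p = A p q := by
    obtain ⟨c, hc⟩ := hv ⟨A.mulVecLin (Pi.single q 1), LinearMap.mem_range_self _ _⟩
    refine ⟨c, fun p ↦ ?_⟩
    simpa using congrFun (congrArg Subtype.val hc) p
  obtain ⟨c, hc⟩ := hcol k
  obtain ⟨d, hd⟩ := hcol l
  rw [← hc, ← hc, ← hd, ← hd]
  ring

/-- The net of conics of type D* contains no matrix of rank 1. -/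
theorem typeDstar_no_rank_one (α β γ : ℂ) :
    (α • (!![0,0,1;0,0,0;1,0,0] : Matrix (Fin 3) (Fin 3) ℂ)
        + β • !![0,0,0;0,0,1;0,1,0]
        + γ • !![0,1,0;1,0,0;0,0,1]).rank ≠ 1 := by
  intro h
  have hminor := mul_apply_eq_of_rank_le_one h.le
  have hγ : γ = 0 := by simpa using hminor 0 1 0 1
  have hα : α = 0 := by simpa using hminor 0 2 0 2
  have hβ : β = 0 := by simpa using hminor 1 2 1 2
  simp [hα, hβ, hγ] at h
end

section
/- Let g, c ∈ ℂ with c ≠ 0 and c ≠ −9g². Let S₁ = [[0,0,1],[0,1,0],[1,0,0]], S₂ = [[0,0,0],[0,0,1],[0,1,0]], S₃ = [[−1,0,g],[0,−2g,0],[g,0,c]], and let L be the ℂ-span of S₁, S₂, S₃ (a net of conics of type A). Then for every (α, β, γ) ∈ ℂ³ with (α, β, γ) ≠ (0,0,0), setting M = α·S₁ + β·S₂ + γ·S₃, the adjugate adj(M) is nonzero and adj(M) ∉ L^⊥, i.e., trace(adj(M)·Sᵢ) ≠ 0 for some i ∈ {1,2,3}. In other words, the ML-base locus of a net of type A is empty.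 -/
open Matrix

/-- For a net of conics of type A, the ML-base locus is empty: for every
nonzero (α,β,γ), the adjugate of M = αS₁ + βS₂ + γS₃ is nonzero and is not in the
polar net, i.e. trace(adj(M)·Sᵢ) ≠ 0 for some i. -/
theorem typeA_ML_base_locus_empty (g c : ℂ) (hc : c ≠ 0) (hc9 : c ≠ -9 * g ^ 2)
    (α β γ : ℂ) (hw : (α, β, γ) ≠ (0, 0, 0)) :
    (α • (!![0,0,1;0,1,0;1,0,0] : Matrix (Fin 3) (Fin 3) ℂ)
        + β • !![0,0,0;0,0,1;0,1,0]
        + γ • !![-1,0,g;0,-2*g,0;g,0,c]).adjugate ≠ 0 ∧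
    (((α • (!![0,0,1;0,1,0;1,0,0] : Matrix (Fin 3) (Fin 3) ℂ)
        + β • !![0,0,0;0,0,1;0,1,0]
        + γ • !![-1,0,g;0,-2*g,0;g,0,c]).adjugate
          * !![0,0,1;0,1,0;1,0,0]).trace ≠ 0 ∨
     ((α • (!![0,0,1;0,1,0;1,0,0] : Matrix (Fin 3) (Fin 3) ℂ)
        + β • !![0,0,0;0,0,1;0,1,0]
        + γ • !![-1,0,g;0,-2*g,0;g,0,c]).adjugate
          * !![0,0,0;0,0,1;0,1,0]).trace ≠ 0 ∨
     ((α • (!![0,0,1;0,1,0;1,0,0] : Matrix (Fin 3) (Fin 3) ℂ)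
        + β • !![0,0,0;0,0,1;0,1,0]
        + γ • !![-1,0,g;0,-2*g,0;g,0,c]).adjugate
          * !![-1,0,g;0,-2*g,0;g,0,c]).trace ≠ 0) := by
  rw [and_iff_right_of_imp fun h h0 => by
    simp only [h0, zero_mul, trace_zero, ne_eq, not_true_eq_false, or_self] at h]
  by_contra h
  push Not at h
  obtain ⟨h1, h2, h3⟩ := h
  simp [adjugate_fin_three, trace_fin_three] at h1 h2 h3
  by_cases hγ : γ = 0
  · subst hγ
    have hα : α = 0 := pow_eq_zero_iff two_ne_zero |>.1 (by linear_combination -h1 / 3)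
    subst hα
    have hβ : β = 0 := pow_eq_zero_iff two_ne_zero |>.1 (by linear_combination h3)
    exact hw (by simp [hβ])
  have hβ : β = 0 := h2.resolve_left hγ
  subst hβ
  have hγ2 : γ ^ 2 ≠ 0 := pow_ne_zero 2 hγ
  have hα : (α + g * γ) * (α - 2 * g * γ) ^ 2 = 0 := by
    linear_combination (α * h1 + γ * h3) / 6 - (α - 2 * g * γ) * h1 / 2
  rcases mul_eq_zero.1 hα with ha | hb
  · refine hc ((mul_eq_zero.1 (?_ : c * γ ^ 2 = 0)).resolve_right hγ2)
    obtain rfl : α = -(g * γ) := eq_neg_of_add_eq_zero_left ha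
    linear_combination -h1
  · obtain rfl : α = 2 * g * γ := sub_eq_zero.1 (pow_eq_zero_iff two_ne_zero |>.1 hb)
    exact hc9 (mul_right_cancel₀ hγ2 (by linear_combination -h1))
end

section
/- Let L be the ℂ-span of E₁₁ = [[1,0,0],[0,0,0],[0,0,0]], E₂₂ = [[0,0,0],[0,1,0],[0,0,0]], and S₃ = [[0,0,1],[0,0,1],[1,1,0]] (a net of conics of type F). Suppose N is a symmetric 3×3 complex matrix with trace(NM) = 0 for all M ∈ L, with N₁₁ + 2N₁₂ = 0 and N₂₂ + 2N₁₂ = 0, and such that E₁₁·N = 0 or E₂₂·N = 0 (matrix product). Then N is a scalar multiple of E₃₃ = [[0,0,0],[0,0,0],[0,0,1]]; in particular no such N has rank 2. -/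
open Matrix

/-- For the type F net L = span{E₁₁, E₂₂, S₃}, a symmetric matrix N in
the polar L^⊥ lying in the span of the reciprocal surface (N₁₁ + 2N₁₂ = 0 and
N₂₂ + 2N₁₂ = 0) and annihilated by one of the rank-one matrices E₁₁, E₂₂ of the net
is a scalar multiple of E₃₃; in particular no such N has rank 2. -/
theorem typeF_no_rank_two_in_base_locus (N : Matrix (Fin 3) (Fin 3) ℂ)
    (hsym : N.IsSymm)
    (hpolar : ∀ M ∈ Submodule.span ℂ
        ({!![1,0,0;0,0,0;0,0,0], !![0,0,0;0,1,0;0,0,0], !![0,0,1;0,0,1;1,1,0]} :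
          Set (Matrix (Fin 3) (Fin 3) ℂ)), (N * M).trace = 0)
    (h1 : N 0 0 + 2 * N 0 1 = 0) (h2 : N 1 1 + 2 * N 0 1 = 0)
    (hX : (!![1,0,0;0,0,0;0,0,0] : Matrix (Fin 3) (Fin 3) ℂ) * N = 0 ∨
          (!![0,0,0;0,1,0;0,0,0] : Matrix (Fin 3) (Fin 3) ℂ) * N = 0) :
    ∃ t : ℂ, N = t • !![0,0,0;0,0,0;0,0,1] := by
  have h10 : N 1 0 = N 0 1 := hsym.apply 0 1
  have h20 : N 2 0 = N 0 2 := hsym.apply 0 2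
  have h21 : N 2 1 = N 1 2 := hsym.apply 1 2
  have htr : N 0 2 + N 1 2 = 0 := by
    simpa [Matrix.trace, Matrix.mul_apply, Fin.sum_univ_three, h20, h21] using
      hpolar _ (Submodule.subset_span (Or.inr (Or.inr rfl)))
  have hzero : N 0 1 = 0 ∧ N 0 2 = 0 ∧ N 1 2 = 0 := by
    rcases hX with hX | hX
    · have h01 : N 0 1 = 0 := by
        simpa [Matrix.mul_apply, Fin.sum_univ_three] using congrFun₂ hX 0 1
      have h02 : N 0 2 = 0 := by
        simpa [Matrix.mul_apply, Fin.sum_univ_three] using congrFun₂ hX 0 2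
      exact ⟨h01, h02, by linear_combination htr - h02⟩
    · have h10' : N 1 0 = 0 := by
        simpa [Matrix.mul_apply, Fin.sum_univ_three] using congrFun₂ hX 1 0
      have h12 : N 1 2 = 0 := by
        simpa [Matrix.mul_apply, Fin.sum_univ_three] using congrFun₂ hX 1 2
      exact ⟨h10 ▸ h10', by linear_combination htr - h12, h12⟩
  obtain ⟨h01, h02, h12⟩ := hzero
  have h00 : N 0 0 = 0 := by linear_combination h1 - 2 * h01
  have h11 : N 1 1 = 0 := by linear_combination h2 - 2 * h01
  refine ⟨N 2 2, ?_⟩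
  ext i j
  fin_cases i <;> fin_cases j <;> simp [h00, h01, h02, h10, h11, h12, h20, h21]
end

section
/- Let L be the ℂ-span of E₁₁ = [[1,0,0],[0,0,0],[0,0,0]], S₂ = [[0,1,0],[1,0,0],[0,0,0]], and S₃ = [[0,0,0],[0,1,0],[0,0,1]] (a net of conics of type F*). Then: (i) for all α, β, γ ∈ ℂ, the adjugate N of α·E₁₁ + β·S₂ + γ·S₃ = [[α,β,0],[β,γ,0],[0,0,γ]] satisfies N₁₃ = 0, N₂₃ = 0, and N₁₁(N₃₃ − N₂₂) + N₁₂² = 0; and (ii) every symmetric 3×3 complex matrix N satisfying N₁₃ = N₂₃ = 0, N₁₁(N₃₃ − N₂₂) + N₁₂² = 0, and trace(NM) = 0 for all M ∈ L is a scalar multiple of diag(0,1,−1). In other words, the set-theoretic ML-base locus of the type F* net is the single rank-two point diag(0,1,−1). -/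
open Matrix

/-- For the type F* net L = span{E₁₁, S₂, S₃}: (i) the adjugates of the
elements of L satisfy the equations N₁₃ = 0, N₂₃ = 0, N₁₁(N₃₃ − N₂₂) + N₁₂² = 0 of the
reciprocal surface; (ii) every symmetric matrix on the reciprocal surface that lies in
the polar L^⊥ is a scalar multiple of diag(0,1,−1). So the set-theoretic ML-base locus
is the single rank-two point diag(0,1,−1). -/
theorem typeFstar_ML_base_locus :
    (∀ α β γ : ℂ,
      (α • (!![1,0,0;0,0,0;0,0,0] : Matrix (Fin 3) (Fin 3) ℂ)
          + β • !![0,1,0;1,0,0;0,0,0]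
          + γ • !![0,0,0;0,1,0;0,0,1]).adjugate 0 2 = 0 ∧
      (α • (!![1,0,0;0,0,0;0,0,0] : Matrix (Fin 3) (Fin 3) ℂ)
          + β • !![0,1,0;1,0,0;0,0,0]
          + γ • !![0,0,0;0,1,0;0,0,1]).adjugate 1 2 = 0 ∧
      (α • (!![1,0,0;0,0,0;0,0,0] : Matrix (Fin 3) (Fin 3) ℂ)
          + β • !![0,1,0;1,0,0;0,0,0]
          + γ • !![0,0,0;0,1,0;0,0,1]).adjugate 0 0 *
        ((α • (!![1,0,0;0,0,0;0,0,0] : Matrix (Fin 3) (Fin 3) ℂ)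
          + β • !![0,1,0;1,0,0;0,0,0]
          + γ • !![0,0,0;0,1,0;0,0,1]).adjugate 2 2 -
         (α • (!![1,0,0;0,0,0;0,0,0] : Matrix (Fin 3) (Fin 3) ℂ)
          + β • !![0,1,0;1,0,0;0,0,0]
          + γ • !![0,0,0;0,1,0;0,0,1]).adjugate 1 1) +
        ((α • (!![1,0,0;0,0,0;0,0,0] : Matrix (Fin 3) (Fin 3) ℂ)
          + β • !![0,1,0;1,0,0;0,0,0]
          + γ • !![0,0,0;0,1,0;0,0,1]).adjugate 0 1) ^ 2 = 0) ∧
    (∀ N : Matrix (Fin 3) (Fin 3) ℂ, N.IsSymm →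
      N 0 2 = 0 → N 1 2 = 0 → N 0 0 * (N 2 2 - N 1 1) + (N 0 1) ^ 2 = 0 →
      (∀ M ∈ Submodule.span ℂ
          ({!![1,0,0;0,0,0;0,0,0], !![0,1,0;1,0,0;0,0,0], !![0,0,0;0,1,0;0,0,1]} :
            Set (Matrix (Fin 3) (Fin 3) ℂ)), (N * M).trace = 0) →
      ∃ t : ℂ, N = t • !![0,0,0;0,1,0;0,0,-1]) := by
  refine ⟨fun α β γ => ?_, fun N hN h02 h12 _ hL => ?_⟩
  · have hM : α • (!![1,0,0;0,0,0;0,0,0] : Matrix (Fin 3) (Fin 3) ℂ)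
          + β • !![0,1,0;1,0,0;0,0,0]
          + γ • !![0,0,0;0,1,0;0,0,1] = !![α,β,0;β,γ,0;0,0,γ] := by
      ext i j
      fin_cases i <;> fin_cases j <;> simp
    rw [hM, adjugate_fin_three_of]
    refine ⟨by simp, by simp, ?_⟩
    simp
    ring
  · have h₁ := hL _ (Submodule.subset_span (Or.inl rfl))
    have h₂ := hL _ (Submodule.subset_span (Or.inr (Or.inl rfl)))
    have h₃ := hL _ (Submodule.subset_span (Or.inr (Or.inr rfl)))
    have h10 := hN.apply 0 1
    have h20 := hN.apply 0 2
    have h21 := hN.apply 1 2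
    simp [trace_fin_three, mul_apply, Fin.sum_univ_three] at h₁ h₂ h₃
    have h01 : N 0 1 = 0 := by linear_combination (h₂ - h10) / 2
    have h22 : N 2 2 = -N 1 1 := by linear_combination h₃
    refine ⟨N 1 1, ?_⟩
    ext i j
    fin_cases i <;> fin_cases j <;> simp [h₁, h01, h02, h12, h10, h20, h21, h22]
end
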